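/- arXiv:2301.12420 — 2 statements merged into one kernel-verified Lean document; each statement's English description precedes it below -/
import Mathlib

section
/- Let (Ω,F,P) be a non-atomic probability space, G ⊆ F a sub-σ-algebra, α ∈ (0,1), and let u1(x) = a1·x^β and u2(x) = a2·x^β on [0,∞) with a1, a2 > 0 and β > 1. Then the conditional generalized quantile ρ_α^G is conditionally positively homogeneous: for all X ∈ L∞(F) and Λ ∈ L∞(G) with Λ ≥ 0 P-a.s., ρ_α^G(Λ·X) = Λ·ρ_α^G(X) P-a.s. -/
open MeasureTheory Set Filter Topology

variable {Ω : Type*}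

/-- `Z ∈ L∞(𝒢)`: `Z` is `𝒢`-measurable and bounded. -/
def BddMeas (𝒢 : MeasurableSpace Ω) (Z : Ω → ℝ) : Prop :=
  Measurable[𝒢] Z ∧ ∃ C : ℝ, ∀ ω, |Z ω| ≤ C

/-- `u ∈ U⁺_icx`: `u` is strictly increasing and convex on `[0,∞)` with `u 0 = 0`, `u 1 = 1`. -/
def Uicx (u : ℝ → ℝ) : Prop :=
  StrictMonoOn u (Set.Ici 0) ∧ ConvexOn ℝ (Set.Ici 0) u ∧ u 0 = 0 ∧ u 1 = 1

/-- `π_α(X,Z) = α·E[u1((X−Z)⁺)] + (1−α)·E[u2((X−Z)⁻)]`. -/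
noncomputable def piRisk {mΩ : MeasurableSpace Ω} (P : Measure Ω) (u1 u2 : ℝ → ℝ) (α : ℝ)
    (X Z : Ω → ℝ) : ℝ :=
  α * ∫ ω, u1 (max (X ω - Z ω) 0) ∂P + (1 - α) * ∫ ω, u2 (max (Z ω - X ω) 0) ∂P

/-- The set of minimizers of `Z ↦ π_α(X,Z)` over `L∞(𝒢)`. -/
def ArgminSet {mΩ : MeasurableSpace Ω} (P : Measure Ω) (𝒢 : MeasurableSpace Ω)
    (u1 u2 : ℝ → ℝ) (α : ℝ) (X : Ω → ℝ) : Set (Ω → ℝ) :=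
  {Z | BddMeas 𝒢 Z ∧ ∀ W, BddMeas 𝒢 W → piRisk P u1 u2 α X Z ≤ piRisk P u1 u2 α X W}

/-- `ρ` is an essential infimum of the family `S` of random variables in the a.s. order. -/
def IsEssInf {mΩ : MeasurableSpace Ω} (P : Measure Ω) (S : Set (Ω → ℝ)) (ρ : Ω → ℝ) : Prop :=
  (∀ Z ∈ S, ρ ≤ᵐ[P] Z) ∧ ∀ W : Ω → ℝ, (∀ Z ∈ S, W ≤ᵐ[P] Z) → W ≤ᵐ[P] ρ

/-- The probability space is non-atomic. -/
def Nonatomic {mΩ : MeasurableSpace Ω} (P : Measure Ω) : Prop :=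
  ∀ A : Set Ω, MeasurableSet[mΩ] A → 0 < P A →
    ∃ B ⊆ A, MeasurableSet[mΩ] B ∧ 0 < P B ∧ P B < P A

/-- The acceptance set of the conditional shortfall risk measure:
`{Z ∈ L∞(𝒢) : E[v(X−Z)|𝒢] ≤ 0 a.s.}`. -/
def ShortfallSet {mΩ : MeasurableSpace Ω} (P : Measure Ω) (𝒢 : MeasurableSpace Ω)
    (v : ℝ → ℝ) (X : Ω → ℝ) : Set (Ω → ℝ) :=
  {Z | BddMeas 𝒢 Z ∧ ∀ᵐ ω ∂P, (P[fun ω' => v (X ω' - Z ω')|𝒢]) ω ≤ 0}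

/-- Left derivative of `u` at `x`, multiplied by the indicator of `{x > 0}`. -/
noncomputable def ldInd (u : ℝ → ℝ) (x : ℝ) : ℝ :=
  if 0 < x then derivWithin u (Set.Iic x) x else 0

/-- Right derivative of `u` at `x`, multiplied by the indicator of `{x ≥ 0}`. -/
noncomputable def rdInd (u : ℝ → ℝ) (x : ℝ) : ℝ :=
  if 0 ≤ x then derivWithin u (Set.Ici x) x else 0

/-- The function `v` built from `u1, u2, α`: `v(x) = α·(u1)'_−(x)` for `x > 0` and
`v(x) = −(1−α)·(u2)'_+(−x)` for `x ≤ 0`. -/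
noncomputable def vFun (u1 u2 : ℝ → ℝ) (α : ℝ) (x : ℝ) : ℝ :=
  if 0 < x then α * derivWithin u1 (Set.Iic x) x
  else -((1 - α) * derivWithin u2 (Set.Ici (-x)) (-x))

/-- `ρ` is a conditional convex risk measure: monotone, conditionally translation
invariant, conditionally convex and normalized. -/
def IsCondConvexRM {mΩ : MeasurableSpace Ω} (P : Measure Ω) (𝒢 : MeasurableSpace Ω)
    (ρ : (Ω → ℝ) → (Ω → ℝ)) : Prop :=
  (∀ X Y : Ω → ℝ, BddMeas mΩ X → BddMeas mΩ Y → X ≤ᵐ[P] Y → ρ X ≤ᵐ[P] ρ Y) ∧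
  (∀ X Z : Ω → ℝ, BddMeas mΩ X → BddMeas 𝒢 Z →
      ρ (fun ω => X ω + Z ω) =ᵐ[P] fun ω => ρ X ω + Z ω) ∧
  (∀ X Y Λ : Ω → ℝ, BddMeas mΩ X → BddMeas mΩ Y → BddMeas 𝒢 Λ →
      (∀ᵐ ω ∂P, 0 ≤ Λ ω ∧ Λ ω ≤ 1) →
      ρ (fun ω => Λ ω * X ω + (1 - Λ ω) * Y ω) ≤ᵐ[P]
        fun ω => Λ ω * ρ X ω + (1 - Λ ω) * ρ Y ω) ∧
  (ρ (fun _ => 0) =ᵐ[P] fun _ => 0)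

/-- `ρ` is a conditional coherent risk measure: a conditional convex risk measure that is
conditionally positively homogeneous. -/
def IsCondCoherentRM {mΩ : MeasurableSpace Ω} (P : Measure Ω) (𝒢 : MeasurableSpace Ω)
    (ρ : (Ω → ℝ) → (Ω → ℝ)) : Prop :=
  IsCondConvexRM P 𝒢 ρ ∧
  ∀ X Λ : Ω → ℝ, BddMeas mΩ X → BddMeas 𝒢 Λ → (∀ᵐ ω ∂P, 0 ≤ Λ ω) →
    ρ (fun ω => Λ ω * X ω) =ᵐ[P] fun ω => Λ ω * ρ X ω

/-- `𝒢` is generated by a finite measurable partition of `Ω`, each cell having positive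
probability. -/
def FinitePartitionGen {mΩ : MeasurableSpace Ω} (P : Measure Ω)
    (𝒢 : MeasurableSpace Ω) : Prop :=
  ∃ (n : ℕ) (A : Fin n → Set Ω),
    (∀ i, MeasurableSet[mΩ] (A i)) ∧ (∀ i, 0 < P (A i)) ∧
    Pairwise (Function.onFun Disjoint A) ∧ (⋃ i, A i) = Set.univ ∧
    𝒢 = MeasurableSpace.generateFrom {s | ∃ i, s = A i}


/-- The loss integrand. -/
noncomputable def lossF (c1 c2 β x : ℝ) : ℝ := c1 * (max x 0) ^ β + c2 * (max (-x) 0) ^ β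

lemma lossF_nonneg {c1 c2 β : ℝ} (h1 : 0 < c1) (h2 : 0 < c2) (x : ℝ) : 0 ≤ lossF c1 c2 β x := by
  unfold lossF; positivity

lemma lossF_cont {c1 c2 β : ℝ} (hβ : 1 < β) : Continuous (lossF c1 c2 β) := by
  unfold lossF
  have hb : (0:ℝ) ≤ β := by linarith
  exact (continuous_const.mul ((continuous_id.max continuous_const).rpow_const
    (fun _ => Or.inr hb))).add (continuous_const.mul
      ((continuous_id.neg.max continuous_const).rpow_const (fun _ => Or.inr hb)))

lemma lossF_smul {c1 c2 β : ℝ} {l : ℝ} (hl : 0 ≤ l) (x : ℝ) :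
    lossF c1 c2 β (l * x) = l ^ β * lossF c1 c2 β x := by
  unfold lossF
  have e1 : max (l * x) 0 = l * max x 0 := by rw [mul_max_of_nonneg _ _ hl, mul_zero]
  have e2 : max (-(l * x)) 0 = l * max (-x) 0 := by
    rw [mul_max_of_nonneg _ _ hl, mul_zero, mul_neg]
  rw [e1, e2, Real.mul_rpow hl (le_max_right _ _), Real.mul_rpow hl (le_max_right _ _)]
  ring

lemma lossF_mono {c1 c2 β : ℝ} (h1 : 0 < c1) (h2 : 0 < c2) (hβ : 1 < β) {x y : ℝ}
    (h : max x 0 ≤ max y 0) (h' : max (-x) 0 ≤ max (-y) 0) :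
    lossF c1 c2 β x ≤ lossF c1 c2 β y := by
  unfold lossF
  have hb : (0:ℝ) ≤ β := by linarith
  have := Real.rpow_le_rpow (le_max_right _ _) h hb
  have := Real.rpow_le_rpow (le_max_right _ _) h' hb
  gcongr

lemma lossF_clip {c1 c2 β : ℝ} (h1 : 0 < c1) (h2 : 0 < c2) (hβ : 1 < β) {x v C : ℝ}
    (hx : |x| ≤ C) :
    lossF c1 c2 β (x - max (-C) (min v C)) ≤ lossF c1 c2 β (x - v) := by
  have := abs_le.1 hx
  apply lossF_mono h1 h2 hβ <;> grind

lemma posrpow_mid {β : ℝ} (hβ : 1 < β) (x y : ℝ) :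
    (max ((x + y) / 2) 0) ^ β ≤ ((max x 0) ^ β + (max y 0) ^ β) / 2 := by
  have hb : (0:ℝ) ≤ β := by linarith
  have h := (convexOn_rpow hβ.le).2
    (mem_Ici.2 (le_max_right x 0)) (mem_Ici.2 (le_max_right y 0))
    (by norm_num : (0:ℝ) ≤ 1/2) (by norm_num : (0:ℝ) ≤ 1/2) (by norm_num)
  simp only [smul_eq_mul] at h
  have h2 : (max ((x + y) / 2) 0) ≤ 1/2 * max x 0 + 1/2 * max y 0 := by grind
  have := Real.rpow_le_rpow (le_max_right _ _) h2 hb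
  linarith

lemma posrpow_mid_lt {β : ℝ} (hβ : 1 < β) {x y : ℝ} (hne : max x 0 ≠ max y 0) :
    (max ((x + y) / 2) 0) ^ β < ((max x 0) ^ β + (max y 0) ^ β) / 2 := by
  have hb : (0:ℝ) ≤ β := by linarith
  have h := (strictConvexOn_rpow hβ).2
    (mem_Ici.2 (le_max_right x 0)) (mem_Ici.2 (le_max_right y 0)) hne
    (by norm_num : (0:ℝ) < 1/2) (by norm_num : (0:ℝ) < 1/2) (by norm_num)
  simp only [smul_eq_mul] at h
  have h2 : (max ((x + y) / 2) 0) ≤ 1/2 * max x 0 + 1/2 * max y 0 := by grind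
  have := Real.rpow_le_rpow (le_max_right _ _) h2 hb
  linarith

lemma lossF_mid {c1 c2 β : ℝ} (h1 : 0 < c1) (h2 : 0 < c2) (hβ : 1 < β) (x y : ℝ) :
    lossF c1 c2 β ((x + y) / 2) ≤ (lossF c1 c2 β x + lossF c1 c2 β y) / 2 := by
  unfold lossF
  have a := mul_le_mul_of_nonneg_left (posrpow_mid hβ x y) h1.le
  have b := mul_le_mul_of_nonneg_left (posrpow_mid hβ (-x) (-y)) h2.le
  have e : -((x + y) / 2) = (-x + -y) / 2 := by ring
  rw [e]; linarith

lemma lossF_mid_eq {c1 c2 β : ℝ} (h1 : 0 < c1) (h2 : 0 < c2) (hβ : 1 < β) {x y : ℝ}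
    (h : lossF c1 c2 β ((x + y) / 2) = (lossF c1 c2 β x + lossF c1 c2 β y) / 2) : x = y := by
  by_contra hne
  unfold lossF at h
  have a := mul_le_mul_of_nonneg_left (posrpow_mid hβ x y) h1.le
  have b := mul_le_mul_of_nonneg_left (posrpow_mid hβ (-x) (-y)) h2.le
  have e : -((x + y) / 2) = (-x + -y) / 2 := by ring
  rw [e] at h
  by_cases hp : max x 0 = max y 0
  · have hq : max (-x) 0 ≠ max (-y) 0 := by grind
    have b' := mul_lt_mul_of_pos_left (posrpow_mid_lt hβ hq) h2
    linarith
  · have a' := mul_lt_mul_of_pos_left (posrpow_mid_lt hβ hp) h1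
    linarith

lemma BddMeas.sub' {m : MeasurableSpace Ω} {X Y : Ω → ℝ} (hX : BddMeas m X) (hY : BddMeas m Y) :
    BddMeas m (fun ω => X ω - Y ω) := by
  obtain ⟨hX, C, hC⟩ := hX
  obtain ⟨hY, D, hD⟩ := hY
  exact ⟨hX.sub hY, C + D, fun ω => (abs_sub _ _).trans (add_le_add (hC ω) (hD ω))⟩

lemma BddMeas.mul' {m : MeasurableSpace Ω} {X Y : Ω → ℝ} (hX : BddMeas m X) (hY : BddMeas m Y) :
    BddMeas m (fun ω => X ω * Y ω) := by
  obtain ⟨hX, C, hC⟩ := hX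
  obtain ⟨hY, D, hD⟩ := hY
  refine ⟨hX.mul hY, C * D, fun ω => ?_⟩
  rw [abs_mul]
  exact mul_le_mul (hC ω) (hD ω) (abs_nonneg _) ((abs_nonneg _).trans (hC ω))

lemma BddMeas.mono' {m m' : MeasurableSpace Ω} (h : m ≤ m') {X : Ω → ℝ} (hX : BddMeas m X) :
    BddMeas m' X := ⟨hX.1.mono h le_rfl, hX.2⟩

lemma BddMeas.comp' {m : MeasurableSpace Ω} {X : Ω → ℝ} (hX : BddMeas m X) {f : ℝ → ℝ}
    (hf : Continuous f) : BddMeas m (fun ω => f (X ω)) := by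
  obtain ⟨hX, C, hC⟩ := hX
  refine ⟨hf.measurable.comp hX, ?_⟩
  obtain ⟨K, hK⟩ := (isCompact_Icc (a := -C) (b := C)).exists_bound_of_continuousOn hf.continuousOn
  exact ⟨K, fun ω => hK _ (abs_le.1 (hC ω))⟩

lemma BddMeas.integrable' {m : MeasurableSpace Ω} {P : Measure Ω} [IsProbabilityMeasure P]
    {X : Ω → ℝ} (hX : BddMeas m X) : Integrable X P := by
  obtain ⟨hX, C, hC⟩ := hX
  exact Integrable.of_bound hX.aestronglyMeasurable C (Eventually.of_forall hC)

lemma piRisk_eq {m : MeasurableSpace Ω} {P : Measure Ω} [IsProbabilityMeasure P]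
    {a1 a2 β α : ℝ} (hβ : 1 < β) {X Z : Ω → ℝ} (hX : BddMeas m X) (hZ : BddMeas m Z) :
    piRisk P (fun x => a1 * x ^ β) (fun x => a2 * x ^ β) α X Z
      = ∫ ω, lossF (α * a1) ((1 - α) * a2) β (X ω - Z ω) ∂P := by
  have i1 := ((hX.sub' hZ).comp' (lossF_cont (c1 := α * a1) (c2 := 0) hβ)).integrable' (P := P)
  have i2 := ((hX.sub' hZ).comp' (lossF_cont (c1 := 0) (c2 := (1 - α) * a2) hβ)).integrable'
    (P := P)
  unfold piRisk
  rw [← integral_const_mul, ← integral_const_mul, ← integral_add]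
  · congr 1; ext ω; simp only [lossF, neg_sub]; ring
  · convert i1 using 2; simp only [lossF]; ring
  · convert i2 using 2; simp only [lossF, neg_sub]; ring

/-- Two minimizers agree almost surely. -/
lemma argmin_unique {m : MeasurableSpace Ω} {P : Measure Ω} [IsProbabilityMeasure P]
    {𝒢 : MeasurableSpace Ω} (hG : 𝒢 ≤ m)
    {a1 a2 β α : ℝ} (h1 : 0 < α * a1) (h2 : 0 < (1 - α) * a2) (hβ : 1 < β) {X Z W : Ω → ℝ}
    (hX : BddMeas m X)
    (hZ : Z ∈ ArgminSet P 𝒢 (fun x => a1 * x ^ β) (fun x => a2 * x ^ β) α X)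
    (hW : W ∈ ArgminSet P 𝒢 (fun x => a1 * x ^ β) (fun x => a2 * x ^ β) α X) :
    Z =ᵐ[P] W := by
  obtain ⟨bZ, oZ⟩ := hZ
  obtain ⟨bW, oW⟩ := hW
  have bM : BddMeas 𝒢 (fun ω => (Z ω + W ω) / 2) := by
    refine ⟨(bZ.1.add bW.1).div_const 2, ?_⟩
    obtain ⟨C, hC⟩ := bZ.2
    obtain ⟨D, hD⟩ := bW.2
    refine ⟨(C + D) / 2, fun ω => ?_⟩
    have := abs_le.1 (hC ω)
    have := abs_le.1 (hD ω)
    rw [abs_le]; constructor <;> linarith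
  have qZ := oZ _ bM
  have qW := oW _ bM
  rw [piRisk_eq hβ hX (bZ.mono' hG), piRisk_eq hβ hX (bM.mono' hG)] at qZ
  rw [piRisk_eq hβ hX (bW.mono' hG), piRisk_eq hβ hX (bM.mono' hG)] at qW
  set F := lossF (α * a1) ((1 - α) * a2) β with hF
  have iZ := ((hX.sub' (bZ.mono' hG)).comp' (lossF_cont (c1 := α * a1) (c2 := (1 - α) * a2) hβ)).integrable' (P := P)
  have iW := ((hX.sub' (bW.mono' hG)).comp' (lossF_cont (c1 := α * a1) (c2 := (1 - α) * a2) hβ)).integrable' (P := P)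
  have iM := ((hX.sub' (bM.mono' hG)).comp' (lossF_cont (c1 := α * a1) (c2 := (1 - α) * a2) hβ)).integrable' (P := P)
  rw [← hF] at iZ iW iM
  have e : ∀ ω, X ω - (Z ω + W ω) / 2 = ((X ω - Z ω) + (X ω - W ω)) / 2 := fun ω => by ring
  have hnn : ∀ ω, 0 ≤ (F (X ω - Z ω) + F (X ω - W ω)) / 2 - F (X ω - (Z ω + W ω) / 2) := by
    intro ω
    rw [e]
    exact sub_nonneg.2 (lossF_mid h1 h2 hβ _ _)
  have iAdd : Integrable (fun ω => (F (X ω - Z ω) + F (X ω - W ω)) / 2) P :=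
    (iZ.add iW).div_const 2
  have iD := iAdd.sub iM
  have hint : ∫ ω, ((F (X ω - Z ω) + F (X ω - W ω)) / 2 - F (X ω - (Z ω + W ω) / 2)) ∂P = 0 := by
    apply le_antisymm
    · rw [integral_sub iAdd iM, integral_div, integral_add iZ iW]
      linarith
    · exact integral_nonneg hnn
  have h0 := (integral_eq_zero_iff_of_nonneg hnn iD).1 hint
  filter_upwards [h0] with ω hω
  simp only [Pi.zero_apply] at hω
  rw [e] at hω
  have := lossF_mid_eq h1 h2 hβ (sub_eq_zero.1 hω).symm
  linarith

/-- Localization: set-wise optimality implies weighted optimality. -/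
lemma weighted_le {m : MeasurableSpace Ω} {P : Measure Ω} [IsProbabilityMeasure P]
    {𝒢 : MeasurableSpace Ω} (hG : 𝒢 ≤ m) {D h : Ω → ℝ} (hD : BddMeas m D) (hh : BddMeas 𝒢 h)
    (h0 : ∀ᵐ ω ∂P, 0 ≤ h ω)
    (hset : ∀ A, MeasurableSet[𝒢] A → 0 ≤ ∫ ω in A, D ω ∂P) :
    0 ≤ ∫ ω, h ω * D ω ∂P := by
  have iD := hD.integrable' (P := P)
  have hc : 0 ≤ᵐ[P] P[D|𝒢] := by
    have : 0 ≤ᵐ[P.trim hG] P[D|𝒢] := by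
      apply ae_nonneg_of_forall_setIntegral_nonneg
      · exact integrable_condExp.trim hG stronglyMeasurable_condExp
      · intro s hs _
        rw [← setIntegral_trim hG stronglyMeasurable_condExp hs, setIntegral_condExp hG iD hs]
        exact hset s hs
    exact ae_le_of_ae_le_trim this
  have ihD : Integrable (fun ω => h ω * D ω) P := ((hh.mono' hG).mul' hD).integrable'
  have hm := condExp_mul_of_stronglyMeasurable_left (μ := P) (m := 𝒢)
    hh.1.stronglyMeasurable ihD iD
  rw [← integral_condExp hG]
  apply integral_nonneg_of_ae
  refine EventuallyLE.trans_eq ?_ hm.symm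
  filter_upwards [h0, hc] with ω a b
  exact mul_nonneg a b

lemma argmin_setwise {m : MeasurableSpace Ω} {P : Measure Ω} [IsProbabilityMeasure P]
    {𝒢 : MeasurableSpace Ω} (hG : 𝒢 ≤ m)
    {a1 a2 β α : ℝ} (hβ : 1 < β) {X Z V : Ω → ℝ}
    (hX : BddMeas m X)
    (hZ : Z ∈ ArgminSet P 𝒢 (fun x => a1 * x ^ β) (fun x => a2 * x ^ β) α X)
    (hV : BddMeas 𝒢 V) {A : Set Ω} (hA : MeasurableSet[𝒢] A) :
    0 ≤ ∫ ω in A, (lossF (α * a1) ((1 - α) * a2) β (X ω - V ω)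
      - lossF (α * a1) ((1 - α) * a2) β (X ω - Z ω)) ∂P := by
  classical
  obtain ⟨bZ, oZ⟩ := hZ
  have bM : BddMeas 𝒢 (A.piecewise V Z) := by
    refine ⟨Measurable.piecewise hA hV.1 bZ.1, ?_⟩
    obtain ⟨C, hC⟩ := hV.2
    obtain ⟨D, hD⟩ := bZ.2
    refine ⟨max C D, fun ω => ?_⟩
    by_cases hω : ω ∈ A
    · simp [hω, hC ω]
    · simp [hω, hD ω]
  have q := oZ _ bM
  rw [piRisk_eq hβ hX (bZ.mono' hG), piRisk_eq hβ hX (bM.mono' hG)] at q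
  have iZ := ((hX.sub' (bZ.mono' hG)).comp' (lossF_cont (c1 := α * a1) (c2 := (1 - α) * a2) hβ)).integrable' (P := P)
  have iM := ((hX.sub' (bM.mono' hG)).comp' (lossF_cont (c1 := α * a1) (c2 := (1 - α) * a2) hβ)).integrable' (P := P)
  rw [← integral_indicator (hG _ hA)]
  rw [← sub_nonneg, ← integral_sub iM iZ] at q
  convert q using 2
  ext ω
  by_cases hω : ω ∈ A <;> simp [hω]

lemma argmin_smul {m : MeasurableSpace Ω} {P : Measure Ω} [IsProbabilityMeasure P]
    {𝒢 : MeasurableSpace Ω} (hG : 𝒢 ≤ m)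
    {a1 a2 β α : ℝ} (h1 : 0 < α * a1) (h2 : 0 < (1 - α) * a2) (hβ : 1 < β) {X Z Λ : Ω → ℝ}
    (hX : BddMeas m X) (hΛ : BddMeas 𝒢 Λ) (hΛ0 : ∀ᵐ ω ∂P, 0 ≤ Λ ω)
    (hZ : Z ∈ ArgminSet P 𝒢 (fun x => a1 * x ^ β) (fun x => a2 * x ^ β) α X) :
    (fun ω => Λ ω * Z ω) ∈ ArgminSet P 𝒢 (fun x => a1 * x ^ β) (fun x => a2 * x ^ β) α
      (fun ω => Λ ω * X ω) := by
  have bZ := hZ.1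
  refine ⟨hΛ.mul' bZ, fun W hW => ?_⟩
  have bLX := (hΛ.mono' hG).mul' hX
  have bLZ := (hΛ.mul' bZ).mono' hG
  rw [piRisk_eq hβ bLX bLZ, piRisk_eq hβ bLX (hW.mono' hG)]
  have Fc := lossF_cont (c1 := α * a1) (c2 := (1 - α) * a2) hβ
  obtain ⟨C, hC⟩ := hX.2
  set V : Ω → ℝ := fun ω => max (-C) (min (W ω / Λ ω) C) with hVdef
  have bV : BddMeas 𝒢 V := by
    refine ⟨measurable_const.max ((hW.1.div hΛ.1).min measurable_const), C, fun ω => ?_⟩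
    have : 0 ≤ C := (abs_nonneg _).trans (hC ω)
    rw [abs_le]; simp only [hVdef]; constructor <;> grind
  have bh : BddMeas 𝒢 (fun ω => Λ ω ^ β) :=
    hΛ.comp' (Real.continuous_rpow_const (by linarith : (0:ℝ) ≤ β))
  have b1 := (hX.sub' (bV.mono' hG)).comp' Fc
  have b2 := (hX.sub' (bZ.mono' hG)).comp' Fc
  have key := weighted_le (P := P) hG (b1.sub' b2) bh
    (hΛ0.mono fun ω h => Real.rpow_nonneg h _)
    (fun A hA => argmin_setwise hG hβ hX hZ bV hA)
  have i1 := ((bh.mono' hG).mul' b1).integrable' (P := P)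
  have i2 := ((bh.mono' hG).mul' b2).integrable' (P := P)
  simp only [mul_sub] at key
  rw [integral_sub i1 i2, sub_nonneg] at key
  have e2 : ∫ ω, lossF (α * a1) ((1 - α) * a2) β (Λ ω * X ω - Λ ω * Z ω) ∂P
      = ∫ ω, Λ ω ^ β * lossF (α * a1) ((1 - α) * a2) β (X ω - Z ω) ∂P := by
    apply integral_congr_ae
    filter_upwards [hΛ0] with ω h
    rw [← mul_sub, lossF_smul h]
  rw [e2]
  refine key.trans (integral_mono_ae i1 ((bLX.sub' (hW.mono' hG)).comp' Fc).integrable' ?_)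
  filter_upwards [hΛ0] with ω h
  rcases h.eq_or_lt with h | h
  · rw [← h, Real.zero_rpow (by linarith), zero_mul]
    exact lossF_nonneg h1 h2 _
  · calc Λ ω ^ β * lossF (α * a1) ((1 - α) * a2) β (X ω - V ω)
        ≤ Λ ω ^ β * lossF (α * a1) ((1 - α) * a2) β (X ω - W ω / Λ ω) :=
          mul_le_mul_of_nonneg_left (lossF_clip h1 h2 hβ (hC ω)) (Real.rpow_nonneg h.le _)
      _ = _ := by
          rw [← lossF_smul h.le, mul_sub, mul_div_cancel₀ _ h.ne']

lemma essInf_ae_eq {m : MeasurableSpace Ω} {P : Measure Ω} {S : Set (Ω → ℝ)} {ρ Z : Ω → ℝ}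
    (h : IsEssInf P S ρ) (hZ : Z ∈ S) (hu : ∀ W ∈ S, Z =ᵐ[P] W) : ρ =ᵐ[P] Z :=
  (h.1 Z hZ).antisymm (h.2 Z fun W hW => (hu W hW).le)

lemma essInf_nonempty {m : MeasurableSpace Ω} {P : Measure Ω} [IsProbabilityMeasure P]
    {S : Set (Ω → ℝ)} {ρ : Ω → ℝ} (h : IsEssInf P S ρ) : S.Nonempty := by
  by_contra hS
  rw [Set.not_nonempty_iff_eq_empty] at hS
  have := h.2 (fun ω => ρ ω + 1) (by simp [hS])
  obtain ⟨ω, hω⟩ := this.exists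
  linarith

/-- Proposition 5.1 (vi): if `u1(x) = a1·x^β`, `u2(x) = a2·x^β` with
`a1, a2 > 0` and `β > 1`, then the conditional generalized quantile is conditionally
positively homogeneous: for `Λ ∈ L∞(𝒢)` with `Λ ≥ 0`, `ρ_α^𝒢(Λ·X) = Λ·ρ_α^𝒢(X)` a.s. -/
theorem conditional_generalized_quantile_positively_homogeneous
    [mΩ : MeasurableSpace Ω] (P : Measure Ω) [IsProbabilityMeasure P]
    (hP : Nonatomic P) (𝒢 : MeasurableSpace Ω) (hG : 𝒢 ≤ mΩ)
    {a1 a2 β : ℝ} (ha1 : 0 < a1) (ha2 : 0 < a2) (hβ : 1 < β)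
    {α : ℝ} (hα : α ∈ Set.Ioo (0:ℝ) 1)
    (X : Ω → ℝ) (hX : BddMeas mΩ X)
    (Λ : Ω → ℝ) (hΛ : BddMeas 𝒢 Λ) (hΛ0 : ∀ᵐ ω ∂P, 0 ≤ Λ ω)
    (ρΛX ρX : Ω → ℝ)
    (hρΛX : IsEssInf P (ArgminSet P 𝒢 (fun x => a1 * x ^ β) (fun x => a2 * x ^ β) α
        (fun ω => Λ ω * X ω)) ρΛX)
    (hρX : IsEssInf P (ArgminSet P 𝒢 (fun x => a1 * x ^ β) (fun x => a2 * x ^ β) α X) ρX) :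
    ρΛX =ᵐ[P] fun ω => Λ ω * ρX ω := by
  have h1 : 0 < α * a1 := mul_pos hα.1 ha1
  have h2 : 0 < (1 - α) * a2 := mul_pos (sub_pos.2 hα.2) ha2
  obtain ⟨Z, hZ⟩ := essInf_nonempty hρX
  have eX : ρX =ᵐ[P] Z := essInf_ae_eq hρX hZ fun W hW => argmin_unique hG h1 h2 hβ hX hZ hW
  have hLZ := argmin_smul hG h1 h2 hβ hX hΛ hΛ0 hZ
  have eL := essInf_ae_eq hρΛX hLZ fun W hW =>
    argmin_unique hG h1 h2 hβ ((hΛ.mono' hG).mul' hX) hLZ hW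
  filter_upwards [eX, eL] with ω a b
  rw [b, a]
end

section
/- Let (Ω,F,P) be a non-atomic probability space, G ⊆ F a sub-σ-algebra, u1, u2 ∈ U⁺_icx, α ∈ (0,1) and X ∈ L∞(F). Let F_G(·,ω) be a regular conditional distribution of X given G. Then for P-almost every ω, ρ_α^G(X)(ω) = ρ_α(F_G(·,ω)), where for a probability distribution F on ℝ with bounded support, ρ_α(F) = inf { z ∈ ℝ : ∫_ℝ v(x−z) dF(x) ≤ 0 } is the static generalized quantile, with v(x) = α·(u1)'_−(x) for x > 0 and v(x) = −(1−α)·(u2)'_+(−x) for x ≤ 0 ((u1)'_− the left derivative of u1, (u2)'_+ the right derivative of u2). -/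
open MeasureTheory Set Filter Topology

variable {Ω : Type*}

/-- The loss function `L(y) = α u1(y⁺) + (1-α) u2(y⁻)`. -/
noncomputable def lossFun (u1 u2 : ℝ → ℝ) (α : ℝ) (y : ℝ) : ℝ :=
  α * u1 (max y 0) + (1 - α) * u2 (max (-y) 0)

lemma lossFun_convex {u1 u2 : ℝ → ℝ} (h1 : Uicx u1) (h2 : Uicx u2)
    {α : ℝ} (hα : α ∈ Set.Ioo (0:ℝ) 1) : ConvexOn ℝ Set.univ (lossFun u1 u2 α) := by
  have key : ∀ u : ℝ → ℝ, Uicx u → ∀ x y a b : ℝ, 0 ≤ a → 0 ≤ b → a + b = 1 →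
      u (max (a * x + b * y) 0) ≤ a * u (max x 0) + b * u (max y 0) := by
    intro u hu x y a b ha hb hab
    have hx : (0:ℝ) ≤ max x 0 := le_max_right _ _
    have hy : (0:ℝ) ≤ max y 0 := le_max_right _ _
    have hc := hu.2.1.2 (Set.mem_Ici.2 hx) (Set.mem_Ici.2 hy) ha hb hab
    simp only [smul_eq_mul] at hc
    refine le_trans ?_ hc
    have hnn : 0 ≤ a * max x 0 + b * max y 0 := by positivity
    refine hu.1.monotoneOn (Set.mem_Ici.2 (le_max_right _ _)) (Set.mem_Ici.2 hnn) ?_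
    refine max_le ?_ hnn
    have := mul_le_mul_of_nonneg_left (le_max_left x 0) ha
    have := mul_le_mul_of_nonneg_left (le_max_left y 0) hb
    linarith
  refine ⟨convex_univ, ?_⟩
  intro x _ y _ a b ha hb hab
  simp only [smul_eq_mul, lossFun]
  have k1 := mul_le_mul_of_nonneg_left (key u1 h1 x y a b ha hb hab) hα.1.le
  have k2 := mul_le_mul_of_nonneg_left (key u2 h2 (-x) (-y) a b ha hb hab)
    (sub_nonneg.2 hα.2.le)
  have e : -(a * x + b * y) = a * -x + b * -y := by ring
  rw [e]
  linarith

lemma derivWithin_Iio_eq_Iic' (f : ℝ → ℝ) (x : ℝ) :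
    derivWithin f (Set.Iio x) x = derivWithin f (Set.Iic x) x := by
  by_cases H : DifferentiableWithinAt ℝ f (Set.Iio x) x
  · have A := H.hasDerivWithinAt.Iic_of_Iio
    exact (A.derivWithin (uniqueDiffOn_Iic x x Set.self_mem_Iic)).symm
  · rw [derivWithin_zero_of_not_differentiableWithinAt H,
      derivWithin_zero_of_not_differentiableWithinAt]
    intro h
    exact H (h.mono Set.Iio_subset_Iic_self)

lemma vFun_eq {u1 u2 : ℝ → ℝ} (h1 : Uicx u1) (h2 : Uicx u2) (α : ℝ) (x : ℝ) :
    vFun u1 u2 α x = derivWithin (lossFun u1 u2 α) (Set.Iio x) x := by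
  rw [derivWithin_Iio_eq_Iic']
  unfold vFun
  split_ifs with hx
  · have : lossFun u1 u2 α =ᶠ[𝓝 x] fun y => α * u1 y := by
      filter_upwards [lt_mem_nhds hx] with y hy
      simp [lossFun, hy.le, h2.2.2.1]
    rw [(this.filter_mono nhdsWithin_le_nhds).derivWithin_eq this.eq_of_nhds,
      derivWithin_const_mul_field]
  · have hx : x ≤ 0 := not_lt.1 hx
    have : ∀ y ∈ Set.Iic x, lossFun u1 u2 α y = (1 - α) * u2 (-y) := by
      intro y hy
      have hy0 : y ≤ 0 := le_trans hy hx
      simp [lossFun, hy0, h1.2.2.1]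
    rw [derivWithin_congr this (this x (Set.mem_Iic.2 le_rfl)), derivWithin_const_mul_field,
      derivWithin_comp_neg]
    simp

lemma loss_subgrad {u1 u2 : ℝ → ℝ} (h1 : Uicx u1) (h2 : Uicx u2)
    {α : ℝ} (hα : α ∈ Set.Ioo (0:ℝ) 1) (a b : ℝ) :
    lossFun u1 u2 α a + vFun u1 u2 α a * (b - a) ≤ lossFun u1 u2 α b := by
  have hc := lossFun_convex h1 h2 hα
  rw [vFun_eq h1 h2]
  rcases lt_trichotomy a b with h | h | h
  · have k1 := hc.leftDeriv_le_rightDeriv_of_mem_interior (x := a) (by simp)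
    have k2 := hc.rightDeriv_le_slope_of_mem_interior (x := a) (y := b) (by simp) (by simp) h
    have k3 := k1.trans k2
    rw [slope_def_field, le_div_iff₀ (by linarith)] at k3
    linarith
  · subst h; simp
  · have k2 := hc.slope_le_leftDeriv_of_mem_interior (x := b) (y := a) (by simp) (by simp) h
    rw [slope_def_field, div_le_iff₀ (by linarith)] at k2
    linarith

lemma vFun_mono {u1 u2 : ℝ → ℝ} (h1 : Uicx u1) (h2 : Uicx u2)
    {α : ℝ} (hα : α ∈ Set.Ioo (0:ℝ) 1) : Monotone (vFun u1 u2 α) := by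
  have hc := (lossFun_convex h1 h2 hα).monotoneOn_leftDeriv
  intro a b hab
  rw [vFun_eq h1 h2, vFun_eq h1 h2]
  exact hc (by simp) (by simp) hab

lemma loss_cont {u1 u2 : ℝ → ℝ} (h1 : Uicx u1) (h2 : Uicx u2)
    {α : ℝ} (hα : α ∈ Set.Ioo (0:ℝ) 1) : Continuous (lossFun u1 u2 α) := by
  rw [← continuousOn_univ]
  exact (lossFun_convex h1 h2 hα).continuousOn isOpen_univ

lemma loss_pos {u1 u2 : ℝ → ℝ} (h1 : Uicx u1) (h2 : Uicx u2)
    {α : ℝ} (hα : α ∈ Set.Ioo (0:ℝ) 1) (x : ℝ) (hx : x ≠ 0) : 0 < lossFun u1 u2 α x := by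
  have hα' : 0 < 1 - α := sub_pos.2 hα.2
  have p : ∀ u : ℝ → ℝ, Uicx u → ∀ y, 0 < y → 0 < u y := by
    intro u hu y hy
    have := hu.1 (Set.mem_Ici.2 le_rfl) (Set.mem_Ici.2 hy.le) hy
    rwa [hu.2.2.1] at this
  rcases lt_or_gt_of_ne hx with h | h
  · have := mul_pos hα' (p u2 h2 (-x) (by linarith))
    simpa [lossFun, max_eq_right h.le, h.le, h1.2.2.1] using this
  · have := mul_pos hα.1 (p u1 h1 x h)
    simpa [lossFun, max_eq_left h.le, h.le, h2.2.2.1] using this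

lemma vFun_pos {u1 u2 : ℝ → ℝ} (h1 : Uicx u1) (h2 : Uicx u2)
    {α : ℝ} (hα : α ∈ Set.Ioo (0:ℝ) 1) (x : ℝ) (hx : 0 < x) : 0 < vFun u1 u2 α x := by
  have h := loss_subgrad h1 h2 hα x 0
  have h0 : lossFun u1 u2 α 0 = 0 := by simp [lossFun, h1.2.2.1, h2.2.2.1]
  have := loss_pos h1 h2 hα x hx.ne'
  by_contra hv
  nlinarith

lemma vFun_nonpos {u1 u2 : ℝ → ℝ} (h1 : Uicx u1) (h2 : Uicx u2)
    {α : ℝ} (hα : α ∈ Set.Ioo (0:ℝ) 1) (x : ℝ) (hx : x ≤ 0) : vFun u1 u2 α x ≤ 0 := by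
  refine (vFun_mono h1 h2 hα hx).trans ?_
  have h0 : lossFun u1 u2 α 0 = 0 := by simp [lossFun, h1.2.2.1, h2.2.2.1]
  -- left derivative at the minimum point
  rw [vFun_eq h1 h2]
  rw [(lossFun_convex h1 h2 hα).leftDeriv_eq_sSup_slope_of_mem_interior (by simp)]
  refine Real.sSup_nonpos ?_
  rintro _ ⟨y, ⟨-, hy⟩, rfl⟩
  rw [slope_def_field, h0]
  have := loss_pos h1 h2 hα y hy.ne
  exact div_nonpos_of_nonneg_of_nonpos (by linarith) (by linarith)

section Static

variable {L v : ℝ → ℝ} {C : ℝ} {μ : Measure ℝ} [IsProbabilityMeasure μ]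

lemma static_ae (hμ : μ (Set.Icc (-C) C)ᶜ = 0) : ∀ᵐ x ∂μ, x ∈ Set.Icc (-C) C := by
  rw [ae_iff]; exact hμ

lemma static_int_L (hL : Continuous L) (hμ : μ (Set.Icc (-C) C)ᶜ = 0) (z : ℝ) :
    Integrable (fun x => L (x - z)) μ := by
  have hc : Continuous fun x => L (x - z) := by fun_prop
  obtain ⟨M, hM⟩ := (isCompact_Icc (a := -C) (b := C)).exists_bound_of_continuousOn hc.continuousOn
  exact Integrable.of_bound hc.aestronglyMeasurable M ((static_ae hμ).mono hM)

lemma static_int_v (hv : Monotone v) (hμ : μ (Set.Icc (-C) C)ᶜ = 0) (z : ℝ) :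
    Integrable (fun x => v (x - z)) μ := by
  have hm : Measurable fun x => v (x - z) := hv.measurable.comp (measurable_id.sub_const z)
  refine Integrable.of_bound hm.aestronglyMeasurable (max |v (-C - z)| |v (C - z)|) ?_
  filter_upwards [static_ae hμ] with x hx
  rw [Real.norm_eq_abs]
  exact abs_le_max_abs_abs (hv (by linarith [hx.1])) (hv (by linarith [hx.2]))

lemma static_subgrad (hL : Continuous L) (hv : Monotone v)
    (hs : ∀ a b, L a + v a * (b - a) ≤ L b) (hμ : μ (Set.Icc (-C) C)ᶜ = 0) (z w : ℝ) :
    ∫ x, L (x - z) ∂μ + (∫ x, v (x - z) ∂μ) * (z - w) ≤ ∫ x, L (x - w) ∂μ := by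
  rw [← integral_mul_const, ← integral_add (static_int_L hL hμ z)
    ((static_int_v hv hμ z).mul_const _)]
  refine integral_mono ((static_int_L hL hμ z).add ((static_int_v hv hμ z).mul_const _))
    (static_int_L hL hμ w) ?_
  intro x
  have := hs (x - z) (x - w)
  have e : x - w - (x - z) = z - w := by ring
  rwa [e] at this

lemma static_phi_anti (hv : Monotone v) (hμ : μ (Set.Icc (-C) C)ᶜ = 0) {z w : ℝ} (h : z ≤ w) :
    ∫ x, v (x - w) ∂μ ≤ ∫ x, v (x - z) ∂μ :=
  integral_mono (static_int_v hv hμ w) (static_int_v hv hμ z) fun x => hv (by linarith)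

lemma static_cont (hL : Continuous L) (hcv : ConvexOn ℝ Set.univ L)
    (hμ : μ (Set.Icc (-C) C)ᶜ = 0) : Continuous fun z => ∫ x, L (x - z) ∂μ := by
  rw [← continuousOn_univ]
  refine ConvexOn.continuousOn isOpen_univ ⟨convex_univ, ?_⟩
  intro z _ w _ a b ha hb hab
  simp only [smul_eq_mul]
  rw [← integral_const_mul, ← integral_const_mul,
    ← integral_add ((static_int_L hL hμ z).const_mul _) ((static_int_L hL hμ w).const_mul _)]
  refine integral_mono (static_int_L hL hμ _)
    (((static_int_L hL hμ z).const_mul _).add ((static_int_L hL hμ w).const_mul _)) ?_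
  intro x
  have := hcv.2 (Set.mem_univ (x - z)) (Set.mem_univ (x - w)) ha hb hab
  simp only [smul_eq_mul] at this
  have e : x - (a * z + b * w) = a * (x - z) + b * (x - w) := by
    have : x = (a + b) * x := by rw [hab, one_mul]
    linear_combination this
  simpa [e] using this

lemma static_upper (hn : ∀ x ≤ 0, v x ≤ 0) (hμ : μ (Set.Icc (-C) C)ᶜ = 0) :
    ∫ x, v (x - C) ∂μ ≤ 0 := by
  refine integral_nonpos_of_ae ?_
  filter_upwards [static_ae hμ] with x hx
  exact hn _ (by linarith [hx.2])

lemma static_lower (hv : Monotone v) (hp : ∀ x, 0 < x → 0 < v x)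
    (hμ : μ (Set.Icc (-C) C)ᶜ = 0) {z : ℝ} (hz : ∫ x, v (x - z) ∂μ ≤ 0) : -C ≤ z := by
  by_contra h
  push Not at h
  have h1 : ∫ x, v (-C - z) ∂μ ≤ ∫ x, v (x - z) ∂μ := by
    refine integral_mono_ae (integrable_const _) (static_int_v hv hμ z) ?_
    filter_upwards [static_ae hμ] with x hx
    exact hv (by linarith [hx.1])
  have h2 := hp (-C - z) (by linarith)
  simp at h1
  linarith

/-- Properties of the static quantile. -/
lemma static_main (hL : Continuous L) (hcv : ConvexOn ℝ Set.univ L) (hv : Monotone v)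
    (hs : ∀ a b, L a + v a * (b - a) ≤ L b) (hp : ∀ x, 0 < x → 0 < v x)
    (hn : ∀ x ≤ 0, v x ≤ 0) (hμ : μ (Set.Icc (-C) C)ᶜ = 0) :
    sInf {z : ℝ | ∫ x, v (x - z) ∂μ ≤ 0} ∈ Set.Icc (-C) C ∧
    (∀ w, ∫ x, L (x - sInf {z : ℝ | ∫ x, v (x - z) ∂μ ≤ 0}) ∂μ ≤ ∫ x, L (x - w) ∂μ) ∧
    (∀ z, (∀ w, ∫ x, L (x - z) ∂μ ≤ ∫ x, L (x - w) ∂μ) →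
      sInf {z : ℝ | ∫ x, v (x - z) ∂μ ≤ 0} ≤ z) := by
  set A := {z : ℝ | ∫ x, v (x - z) ∂μ ≤ 0} with hA
  have hCA : C ∈ A := static_upper hn hμ
  have hbd : BddBelow A := ⟨-C, fun z hz => static_lower hv hp hμ hz⟩
  have hdec : ∀ w z, w < z → z < sInf A → ∫ x, L (x - z) ∂μ < ∫ x, L (x - w) ∂μ := by
    intro w z hwz hz
    have hzA : z ∉ A := fun h => absurd (csInf_le hbd h) (not_le.2 hz)
    have hpos : 0 < ∫ x, v (x - z) ∂μ := by
      by_contra h; exact hzA (not_lt.1 h)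
    have := static_subgrad hL hv hs hμ z w
    nlinarith
  have hcont := static_cont hL hcv hμ
  refine ⟨⟨le_csInf ⟨C, hCA⟩ fun z hz => static_lower hv hp hμ hz, csInf_le hbd hCA⟩, ?_, ?_⟩
  · intro w
    rcases lt_trichotomy w (sInf A) with h | h | h
    · have ht : Tendsto (fun z => ∫ x, L (x - z) ∂μ) (𝓝[<] (sInf A))
          (𝓝 (∫ x, L (x - sInf A) ∂μ)) := (hcont.tendsto _).mono_left nhdsWithin_le_nhds
      refine le_of_tendsto ht ?_
      filter_upwards [Ioo_mem_nhdsLT h] with z hz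
      exact (hdec w z hz.1 hz.2).le
    · rw [h]
    · have ht : Tendsto (fun z => ∫ x, L (x - z) ∂μ) (𝓝[>] (sInf A))
          (𝓝 (∫ x, L (x - sInf A) ∂μ)) := (hcont.tendsto _).mono_left nhdsWithin_le_nhds
      refine le_of_tendsto ht ?_
      filter_upwards [Ioo_mem_nhdsGT h] with z hz
      obtain ⟨y, hy, hyz⟩ := exists_lt_of_csInf_lt ⟨C, hCA⟩ hz.1
      have hzA : ∫ x, v (x - z) ∂μ ≤ 0 := (static_phi_anti hv hμ hyz.le).trans hy
      have := static_subgrad hL hv hs hμ z w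
      nlinarith [hz.2]
  · intro z hz
    by_contra h
    push Not at h
    obtain ⟨y, hy1, hy2⟩ := exists_between h
    exact absurd (hdec z y hy1 hy2) (not_lt.2 (hz y))

end Static

open ProbabilityTheory in
lemma disint_aux {T : Type*} [mΩ : MeasurableSpace Ω] [mT : MeasurableSpace T] (P : Measure Ω)
    [IsProbabilityMeasure P] (Y : Ω → T) (hY : Measurable Y) (X : Ω → ℝ) (hX : Measurable X)
    (K : Kernel T ℝ) [IsMarkovKernel K]
    (h : ∀ s t, MeasurableSet s → MeasurableSet t →
      P (Y ⁻¹' s ∩ X ⁻¹' t) = ∫⁻ ω in Y ⁻¹' s, K (Y ω) t ∂P)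
    (f : T × ℝ → ℝ) (hf : Measurable f) (hfi : Integrable (fun ω => f (Y ω, X ω)) P) :
    Integrable (fun ω => ∫ x, f (Y ω, x) ∂(K (Y ω))) P ∧
    ∫ ω, f (Y ω, X ω) ∂P = ∫ ω, ∫ x, f (Y ω, x) ∂(K (Y ω)) ∂P := by
  have hYX : Measurable fun ω => (Y ω, X ω) := hY.prodMk hX
  have : IsProbabilityMeasure (P.map Y) := Measure.isProbabilityMeasure_map hY.aemeasurable
  have heq : P.map (fun ω => (Y ω, X ω)) = (P.map Y) ⊗ₘ K := by
    have := Measure.isProbabilityMeasure_map (μ := P) hYX.aemeasurable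
    refine Measure.ext_prod ?_
    intro s t hs ht
    rw [Measure.compProd_apply_prod hs ht, Measure.map_apply hYX (hs.prod ht),
      setLIntegral_map hs (K.measurable_coe ht) hY, ← h s t hs ht]
    rfl
  have hfi' : Integrable f ((P.map Y) ⊗ₘ K) := by
    rw [← heq]
    exact (integrable_map_measure hf.aestronglyMeasurable hYX.aemeasurable).2 hfi
  have hsm : StronglyMeasurable fun t => ∫ x, f (t, x) ∂(K t) :=
    hf.stronglyMeasurable.integral_kernel_prod_right'
  constructor
  · have : Integrable (fun t => ∫ x, f (t, x) ∂(K t)) (P.map Y) :=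
      MeasureTheory.Integrable.integral_compProd (κ := Kernel.const Unit (P.map Y))
        (η := Kernel.prodMkLeft Unit K) (a := ()) hfi'
    exact (integrable_map_measure hsm.aestronglyMeasurable hY.aemeasurable).1 this
  · calc ∫ ω, f (Y ω, X ω) ∂P = ∫ p, f p ∂(P.map (fun ω => (Y ω, X ω))) :=
          (integral_map hYX.aemeasurable hf.aestronglyMeasurable).symm
      _ = ∫ t, ∫ x, f (t, x) ∂(K t) ∂(P.map Y) := by
          rw [heq, Measure.integral_compProd hfi']
      _ = _ := integral_map hY.aemeasurable hsm.aestronglyMeasurable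

open ProbabilityTheory in
lemma kernel_exists_aux {T : Type*} [MeasurableSpace T] (κ : T → Measure ℝ)
    (hκprob : ∀ t, IsProbabilityMeasure (κ t))
    (hκmeas : ∀ B : Set ℝ, MeasurableSet B → Measurable fun t => (κ t B).toReal)
    (C : ℝ) (hC : 0 ≤ C) :
    ∃ K : Kernel T ℝ, IsMarkovKernel K ∧ (∀ t, K t (Set.Icc (-C) C)ᶜ = 0) ∧
      ∀ t, κ t (Set.Icc (-C) C)ᶜ = 0 → K t = κ t := by
  classical
  have hm : ∀ B : Set ℝ, MeasurableSet B → Measurable fun t => κ t B := by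
    intro B hB
    have := (hκmeas B hB).ennreal_ofReal
    simpa [ENNReal.ofReal_toReal, measure_ne_top] using this
  have hS : MeasurableSet {t | κ t (Set.Icc (-C) C)ᶜ = 0} :=
    hm _ measurableSet_Icc.compl (measurableSet_singleton 0)
  have hκ : Measurable κ := Measure.measurable_of_measurable_coe _ fun s hs => hm s hs
  let K : Kernel T ℝ :=
    ⟨fun t => if κ t (Set.Icc (-C) C)ᶜ = 0 then κ t else Measure.dirac 0,
      Measurable.ite hS hκ measurable_const⟩
  have hK : ∀ t, K t = if κ t (Set.Icc (-C) C)ᶜ = 0 then κ t else Measure.dirac 0 :=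
    fun t => rfl
  refine ⟨K, ⟨fun t => ?_⟩, fun t => ?_, fun t ht => ?_⟩
  · rw [hK]; split_ifs
    · exact hκprob t
    · infer_instance
  · rw [hK]; split_ifs with h
    · exact h
    · rw [Measure.dirac_apply' _ measurableSet_Icc.compl]
      simp [hC]
  · rw [hK, if_pos ht]

open ProbabilityTheory in
lemma quantile_meas_aux {T : Type*} [MeasurableSpace T] {v : ℝ → ℝ} {C : ℝ}
    (K : Kernel T ℝ) [IsMarkovKernel K] (hv : Monotone v) (hp : ∀ x, 0 < x → 0 < v x)
    (hn : ∀ x ≤ 0, v x ≤ 0) (hK : ∀ t, K t (Set.Icc (-C) C)ᶜ = 0) :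
    Measurable fun t => sInf {z : ℝ | ∫ x, v (x - z) ∂(K t) ≤ 0} := by
  refine measurable_of_Iio fun c => ?_
  have : (fun t => sInf {z : ℝ | ∫ x, v (x - z) ∂(K t) ≤ 0}) ⁻¹' Set.Iio c =
      ⋃ q : ℚ, ⋃ _ : (q : ℝ) < c, {t | ∫ x, v (x - q) ∂(K t) ≤ 0} := by
    ext t
    simp only [Set.mem_preimage, Set.mem_Iio, Set.mem_iUnion, Set.mem_ofPred_eq, exists_prop]
    constructor
    · intro h
      obtain ⟨y, hy, hyc⟩ := exists_lt_of_csInf_lt ⟨C, static_upper hn (hK t)⟩ h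
      obtain ⟨q, hq1, hq2⟩ := exists_rat_btwn hyc
      exact ⟨q, hq2, (static_phi_anti hv (hK t) hq1.le).trans hy⟩
    · rintro ⟨q, hq, hqA⟩
      exact (csInf_le ⟨-C, fun z hz => static_lower hv hp (hK t) hz⟩ hqA).trans_lt hq
  rw [this]
  refine MeasurableSet.iUnion fun q => MeasurableSet.iUnion fun _ => ?_
  have hm : Measurable fun x : ℝ => v (x - q) := hv.measurable.comp (measurable_id.sub_const _)
  exact measurableSet_le (hm.stronglyMeasurable.integral_kernel (κ := K)).measurable
    measurable_const

lemma integrable_cont_aux [mΩ : MeasurableSpace Ω] (P : Measure Ω) [IsProbabilityMeasure P]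
    {g : ℝ → ℝ} (hg : Continuous g) {Y : Ω → ℝ} (hY : BddMeas mΩ Y) :
    Integrable (fun ω => g (Y ω)) P := by
  obtain ⟨hm, D, hD⟩ := hY
  obtain ⟨M, hM⟩ := (isCompact_Icc (a := -D) (b := D)).exists_bound_of_continuousOn hg.continuousOn
  exact Integrable.of_bound (hg.measurable.comp hm).aestronglyMeasurable M
    (Eventually.of_forall fun ω => hM _ (abs_le.1 (hD ω)))

lemma bddMeas_sub_aux [mΩ : MeasurableSpace Ω] {X Z : Ω → ℝ} (hX : BddMeas mΩ X)
    (hZ : BddMeas mΩ Z) : BddMeas mΩ (fun ω => X ω - Z ω) := by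
  obtain ⟨hm, D, hD⟩ := hX
  obtain ⟨hm', D', hD'⟩ := hZ
  exact ⟨hm.sub hm', D + D', fun ω => (abs_sub _ _).trans (add_le_add (hD ω) (hD' ω))⟩

lemma u1_cont {u1 u2 : ℝ → ℝ} (h1 : Uicx u1) (h2 : Uicx u2) {α : ℝ} (hα : α ∈ Set.Ioo (0:ℝ) 1) :
    Continuous fun y => u1 (max y 0) := by
  have : (fun y => u1 (max y 0)) = fun y => α⁻¹ * lossFun u1 u2 α (max y 0) := by
    funext y
    have := hα.1.ne'
    simp [lossFun, h2.2.2.1]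
    field_simp
  rw [this]
  have := loss_cont h1 h2 hα
  fun_prop

lemma piRisk_eq_s15 [mΩ : MeasurableSpace Ω] (P : Measure Ω) [IsProbabilityMeasure P]
    {u1 u2 : ℝ → ℝ} (h1 : Uicx u1) (h2 : Uicx u2) {α : ℝ} (hα : α ∈ Set.Ioo (0:ℝ) 1)
    {X Z : Ω → ℝ} (hX : BddMeas mΩ X) (hZ : BddMeas mΩ Z) :
    piRisk P u1 u2 α X Z = ∫ ω, lossFun u1 u2 α (X ω - Z ω) ∂P := by
  have i1 := integrable_cont_aux P (u1_cont h1 h2 hα) (bddMeas_sub_aux hX hZ)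
  have i2 := integrable_cont_aux P (u1_cont h2 h1 hα) (bddMeas_sub_aux hZ hX)
  unfold piRisk
  rw [← integral_const_mul, ← integral_const_mul, ← integral_add (i1.const_mul _) (i2.const_mul _)]
  simp [lossFun]

/-- Theorem 6.1 (i): the conditional generalized quantile equals, for
almost every `ω`, the static generalized quantile
`ρ_α(F) = inf{z : ∫ v(x−z) dF(x) ≤ 0}` of the regular conditional distribution
`F_𝒢(·,ω)` of `X` given `𝒢`. -/
theorem conditional_generalized_quantile_eq_static_of_regular_cond_dist
    [mΩ : MeasurableSpace Ω] (P : Measure Ω) [IsProbabilityMeasure P]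
    (hP : Nonatomic P) (𝒢 : MeasurableSpace Ω) (hG : 𝒢 ≤ mΩ)
    {u1 u2 : ℝ → ℝ} (h1 : Uicx u1) (h2 : Uicx u2)
    {α : ℝ} (hα : α ∈ Set.Ioo (0:ℝ) 1)
    (X : Ω → ℝ) (hX : BddMeas mΩ X)
    (κ : Ω → Measure ℝ)
    (hκprob : ∀ ω, IsProbabilityMeasure (κ ω))
    (hκmeas : ∀ B : Set ℝ, MeasurableSet B → Measurable[𝒢] fun ω => (κ ω B).toReal)
    (hκcond : ∀ B : Set ℝ, MeasurableSet B →
        (fun ω => (κ ω B).toReal) =ᵐ[P]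
          P[(X ⁻¹' B).indicator (fun _ => (1:ℝ))|𝒢])
    (ρ : Ω → ℝ) (hρ : IsEssInf P (ArgminSet P 𝒢 u1 u2 α X) ρ) :
    ∀ᵐ ω ∂P, ρ ω = sInf {z : ℝ | ∫ x, vFun u1 u2 α (x - z) ∂(κ ω) ≤ 0} := by

  classical
  obtain ⟨hXm, C, hXC⟩ := id hX
  have hC : 0 ≤ C := by
    obtain ⟨ω⟩ : Nonempty Ω := P.nonempty_of_neZero
    exact (abs_nonneg _).trans (hXC ω)
  set L := lossFun u1 u2 α with hLdef
  set v := vFun u1 u2 α with hvdef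
  have hL : Continuous L := loss_cont h1 h2 hα
  have hcv : ConvexOn ℝ Set.univ L := lossFun_convex h1 h2 hα
  have hv : Monotone v := vFun_mono h1 h2 hα
  have hs : ∀ a b, L a + v a * (b - a) ≤ L b := loss_subgrad h1 h2 hα
  have hp : ∀ x, 0 < x → 0 < v x := vFun_pos h1 h2 hα
  have hn : ∀ x ≤ 0, v x ≤ 0 := vFun_nonpos h1 h2 hα
  obtain ⟨K, hKM, hKC, hKκ⟩ := @kernel_exists_aux Ω 𝒢 κ hκprob hκmeas C hC
  -- `κ` is concentrated on `[-C, C]` almost surely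
  have hae : ∀ᵐ ω ∂P, K ω = κ ω := by
    have h0 := hκcond _ (measurableSet_Icc (a := -C) (b := C)).compl
    have hempty : X ⁻¹' (Set.Icc (-C) C)ᶜ = ∅ := by
      ext ω
      simpa using abs_le.1 (hXC ω)
    rw [hempty, Set.indicator_empty] at h0
    have hz : P[(fun _ => (0:ℝ))|𝒢] = 0 := condExp_zero
    rw [hz] at h0
    filter_upwards [h0] with ω hω
    refine hKκ ω ?_
    have := (ENNReal.toReal_eq_zero_iff _).1 hω
    exact this.resolve_right (measure_ne_top _ _)
  have hdis : ∀ s t, MeasurableSet[𝒢] s → MeasurableSet t →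
      P (id ⁻¹' s ∩ X ⁻¹' t) = ∫⁻ ω in id ⁻¹' s, K (id ω) t ∂P := by
    intro s t hs' ht
    simp only [Set.preimage_id, id]
    have hXt : MeasurableSet[mΩ] (X ⁻¹' t) := hXm ht
    have e1 : ∫⁻ ω in s, K ω t ∂P = ∫⁻ ω in s, ENNReal.ofReal (κ ω t).toReal ∂P := by
      refine lintegral_congr_ae (ae_restrict_of_ae ?_)
      filter_upwards [hae] with ω hω
      rw [hω, ENNReal.ofReal_toReal (measure_ne_top _ _)]
    have hmt : Measurable[mΩ] fun ω => (κ ω t).toReal := (hκmeas t ht).mono hG le_rfl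
    have hit : Integrable (fun ω => (κ ω t).toReal) P := by
      refine Integrable.of_bound hmt.aestronglyMeasurable 1 (Eventually.of_forall fun ω => ?_)
      rw [Real.norm_eq_abs, abs_of_nonneg ENNReal.toReal_nonneg]
      exact ENNReal.toReal_le_of_le_ofReal zero_le_one (by simpa using prob_le_one)
    rw [e1, ← ofReal_integral_eq_lintegral_ofReal hit.integrableOn
      (Eventually.of_forall fun ω => ENNReal.toReal_nonneg)]
    have e2 : ∫ ω in s, (κ ω t).toReal ∂P = (P (s ∩ X ⁻¹' t)).toReal := by
      rw [setIntegral_congr_ae (g := P[(X ⁻¹' t).indicator (fun _ => (1:ℝ))|𝒢]) (hG s hs')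
        ((hκcond t ht).mono fun ω h _ => h),
        setIntegral_condExp hG ((integrable_const _).indicator hXt) hs',
        setIntegral_indicator hXt]
      simp [Measure.real]
    rw [e2, ENNReal.ofReal_toReal (measure_ne_top _ _)]
  set S : Ω → ℝ := fun ω => sInf {z : ℝ | ∫ x, v (x - z) ∂(K ω) ≤ 0} with hS
  have hst := fun ω => static_main (μ := K ω) hL hcv hv hs hp hn (hKC ω)
  have hSm : BddMeas 𝒢 S :=
    ⟨@quantile_meas_aux Ω 𝒢 v C K hKM hv hp hn hKC, C, fun ω => abs_le.2 (hst ω).1⟩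
  -- disintegration of the risk
  have hrisk : ∀ W, BddMeas 𝒢 W → Integrable (fun ω => ∫ x, L (x - W ω) ∂(K ω)) P ∧
      piRisk P u1 u2 α X W = ∫ ω, ∫ x, L (x - W ω) ∂(K ω) ∂P := by
    intro W hW
    have hW' : BddMeas mΩ W := ⟨hW.1.mono hG le_rfl, hW.2⟩
    rw [@piRisk_eq_s15 Ω mΩ P _ u1 u2 h1 h2 α hα X W hX hW']
    have hf : Measurable[@Prod.instMeasurableSpace Ω ℝ 𝒢 _] fun p : Ω × ℝ => L (p.2 - W p.1) :=
      hL.measurable.comp (measurable_snd.sub (hW.1.comp measurable_fst))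
    exact @disint_aux Ω Ω mΩ 𝒢 P _ id (measurable_id'' hG) X hXm K hKM hdis
      (fun p => L (p.2 - W p.1)) hf
      (@integrable_cont_aux Ω mΩ P _ L hL _ (@bddMeas_sub_aux Ω mΩ X W hX hW'))
  have hSarg : S ∈ ArgminSet P 𝒢 u1 u2 α X := by
    refine ⟨hSm, fun W hW => ?_⟩
    rw [(hrisk S hSm).2, (hrisk W hW).2]
    exact integral_mono (hrisk S hSm).1 (hrisk W hW).1 fun ω => (hst ω).2.1 (W ω)
  have hSle : ∀ Z ∈ ArgminSet P 𝒢 u1 u2 α X, S ≤ᵐ[P] Z := by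
    rintro Z ⟨hZ, hZmin⟩
    have hle := hZmin S hSm
    rw [(hrisk S hSm).2, (hrisk Z hZ).2] at hle
    have hmono : (fun ω => ∫ x, L (x - S ω) ∂(K ω)) ≤ᵐ[P] fun ω => ∫ x, L (x - Z ω) ∂(K ω) :=
      Eventually.of_forall fun ω => (hst ω).2.1 (Z ω)
    have heq := (integral_eq_iff_of_ae_le (hrisk S hSm).1 (hrisk Z hZ).1 hmono).1
      (le_antisymm (integral_mono_ae (hrisk S hSm).1 (hrisk Z hZ).1 hmono) hle)
    filter_upwards [heq] with ω hω
    refine (hst ω).2.2 (Z ω) fun w => ?_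
    exact hω.symm.le.trans ((hst ω).2.1 w)
  filter_upwards [hρ.1 S hSarg, hρ.2 S hSle, hae] with ω hω1 hω2 hω3
  rw [← hω3]
  exact le_antisymm hω1 hω2
end
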